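/- For Lebesgue-almost every irrational x ∈ (0,1), the limit inferior of the arithmetic means of the negative continued fraction digits equals 2: liminf_{n→∞} (1/n) ∑_{k=1}^{n} a'_k(x) = 2. -/

import Mathlib

open MeasureTheory Filter Real

/-- The negative continued fraction map `T(y) = -1/y - ⌊-1/y⌋` (with `T 0 = 0`). -/
noncomputable def negT (y : ℝ) : ℝ := Int.fract (-1 / y)

/-- The `n`-th negative continued fraction digit `a'_n(x) = ⌈1 / T^{n-1}(1-x)⌉`. -/
noncomputable def negDigit (x : ℝ) (n : ℕ) : ℕ := (⌈1 / negT^[n - 1] (1 - x)⌉).toNat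

open Set

/-- The Gauss map of the regular continued fraction. -/
noncomputable def gaussMap (x : ℝ) : ℝ := Int.fract x⁻¹
/-- The first digit of the regular continued fraction. -/
noncomputable def gaussDigit (x : ℝ) : ℕ := ⌊x⁻¹⌋₊

/-- The inverse branch of the Gauss map on the points with first digit `m + 1`. -/
noncomputable def gaussBranch (m : ℕ) (s : ℝ) : ℝ := ((m : ℝ) + 1 + s)⁻¹

/-- The measure on `(0, 1)` with density `1 / (1 + r * t) ^ 2`. These measures are preserved, up to
scaling, by the branches of the Gauss map. -/
noncomputable def mobiusMeasure (r : ℝ) : Measure ℝ :=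
  (volume.restrict (Ioo 0 1)).withDensity fun t => ENNReal.ofReal (1 / (1 + r * t) ^ 2)

/-- Membership in `D` is determined by the first `n` regular continued fraction digits. -/
def DependsOnDigits (n : ℕ) (D : Set ℝ) : Prop :=
  ∀ x ∈ Ioo (0 : ℝ) 1, ∀ y ∈ Ioo (0 : ℝ) 1,
    (∀ i < n, gaussDigit (gaussMap^[i] x) = gaussDigit (gaussMap^[i] y)) → x ∈ D → y ∈ D

lemma measurable_gaussMap : Measurable gaussMap := by
  unfold gaussMap; fun_prop

lemma measurable_gaussDigit : Measurable gaussDigit :=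
  Nat.measurable_floor.comp measurable_inv

lemma measurable_gaussBranch (m : ℕ) : Measurable (gaussBranch m) := by
  unfold gaussBranch; fun_prop

lemma gaussBranch_mem {m : ℕ} {s : ℝ} (hs : s ∈ Ioo (0 : ℝ) 1) :
    gaussBranch m s ∈ Ioo (0 : ℝ) 1 := by
  have := hs.1
  have hm : (0 : ℝ) ≤ m := m.cast_nonneg
  exact ⟨by unfold gaussBranch; positivity, inv_lt_one_of_one_lt₀ (by linarith)⟩

lemma gaussMap_gaussBranch {m : ℕ} {s : ℝ} (hs : s ∈ Ioo (0 : ℝ) 1) :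
    gaussMap (gaussBranch m s) = s := by
  rw [gaussMap, gaussBranch, inv_inv, Int.fract_eq_iff]
  exact ⟨hs.1.le, hs.2, m + 1, by push_cast; ring⟩

lemma gaussDigit_gaussBranch {m : ℕ} {s : ℝ} (hs : s ∈ Ioo (0 : ℝ) 1) :
    gaussDigit (gaussBranch m s) = m + 1 := by
  have := hs.1
  have := hs.2
  rw [gaussDigit, gaussBranch, inv_inv, Nat.floor_eq_iff (by positivity)]
  push_cast
  constructor <;> linarith

lemma DependsOnDigits.preimage {n : ℕ} {D : Set ℝ} (hD : DependsOnDigits (n + 1) D) (m : ℕ) :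
    DependsOnDigits n (gaussBranch m ⁻¹' D) := by
  intro x hx y hy h
  refine hD _ (gaussBranch_mem hx) _ (gaussBranch_mem hy) fun i hi => ?_
  rcases i with _ | i
  · simp [gaussDigit_gaussBranch hx, gaussDigit_gaussBranch hy]
  · simpa [gaussMap_gaussBranch hx, gaussMap_gaussBranch hy] using h i (by omega)

lemma gaussMap_mem {x : ℝ} (h : Irrational x) : gaussMap x ∈ Ioo (0 : ℝ) 1 := by
  refine ⟨lt_of_le_of_ne (Int.fract_nonneg _) fun h0 => ?_, Int.fract_lt_one _⟩
  obtain ⟨z, hz⟩ := Int.fract_eq_zero_iff.1 h0.symm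
  exact h.inv.ne_int z hz.symm

lemma irrational_gaussMap {x : ℝ} (h : Irrational x) : Irrational (gaussMap x) :=
  h.inv.sub_intCast _

lemma iUnion_gaussBranch_ae_eq :
    (⋃ m, gaussBranch m '' Ioo (0 : ℝ) 1) =ᵐ[volume] Ioo (0 : ℝ) 1 := by
  have hirr : ∀ᵐ x : ℝ, Irrational x := by
    have := (countable_range ((↑) : ℚ → ℝ)).ae_notMem volume
    simpa [Irrational] using this
  filter_upwards [hirr] with x hx
  refine propext ⟨fun h => ?_, fun h => ?_⟩
  · obtain ⟨m, s, hs, rfl⟩ := mem_iUnion.1 h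
    exact gaussBranch_mem hs
  · refine mem_iUnion.2 ⟨⌊x⁻¹⌋₊ - 1, gaussMap x, gaussMap_mem hx, ?_⟩
    have h1 : 1 ≤ ⌊x⁻¹⌋₊ := Nat.le_floor (by simpa using (one_lt_inv₀ h.1).2 h.2 |>.le)
    have : (0:ℝ) ≤ x⁻¹ := inv_nonneg.2 h.1.le
    rw [gaussBranch, gaussMap, inv_eq_iff_eq_inv, Nat.cast_sub h1, natCast_floor_eq_intCast_floor this,
      Int.fract]
    push_cast
    ring

lemma setLIntegral_eq_tsum_gaussBranch {f : ℝ → ENNReal} :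
    ∫⁻ x in Ioo (0 : ℝ) 1, f x =
      ∑' m : ℕ, ∫⁻ s in Ioo (0 : ℝ) 1,
        ENNReal.ofReal (1 / ((m : ℝ) + 1 + s) ^ 2) * f (gaussBranch m s) := by
  have hinj (m : ℕ) : InjOn (gaussBranch m) (Ioo (0 : ℝ) 1) := fun a ha b hb h => by
    rw [← gaussMap_gaussBranch ha, h, gaussMap_gaussBranch hb]
  have hder (m : ℕ) : ∀ s ∈ Ioo (0 : ℝ) 1, HasDerivWithinAt (gaussBranch m)
      (-1 / ((m : ℝ) + 1 + s) ^ 2) (Ioo (0 : ℝ) 1) s := fun s hs => by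
    have := hs.1
    exact (((hasDerivAt_id s).const_add ((m : ℝ) + 1)).inv
      (by simp only [id]; positivity)).hasDerivWithinAt
  rw [← setLIntegral_congr iUnion_gaussBranch_ae_eq, lintegral_iUnion]
  · refine tsum_congr fun m => ?_
    rw [lintegral_image_eq_lintegral_abs_deriv_mul measurableSet_Ioo (hder m) (hinj m)]
    simp only [neg_div, abs_neg, abs_div, abs_one, abs_sq]
  · exact fun m => (measurableSet_Ioo.image_of_measurable_injOn (measurable_gaussBranch m) (hinj m))
  · intro m k hmk
    refine disjoint_left.2 ?_
    rintro _ ⟨s, hs, rfl⟩ ⟨t, ht, h⟩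
    have := congrArg gaussDigit h
    rw [gaussDigit_gaussBranch hs, gaussDigit_gaussBranch ht] at this
    exact hmk (by omega)

lemma mobiusMeasure_apply (r : ℝ) {D : Set ℝ} (hD : MeasurableSet D) :
    mobiusMeasure r D = ∫⁻ x in Ioo (0 : ℝ) 1,
      D.indicator (fun t => ENNReal.ofReal (1 / (1 + r * t) ^ 2)) x := by
  rw [mobiusMeasure, withDensity_apply _ hD, lintegral_indicator hD]

lemma mobiusMeasure_congr (r : ℝ) {D D' : Set ℝ}
    (h : ∀ x ∈ Ioo (0 : ℝ) 1, x ∈ D ↔ x ∈ D') : mobiusMeasure r D = mobiusMeasure r D' := by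
  refine measure_congr ?_
  refine (withDensity_absolutelyContinuous _ _).ae_le ?_
  filter_upwards [ae_restrict_mem measurableSet_Ioo] with x hx
  exact propext (h x hx)

lemma mobiusMeasure_eq_tsum {r : ℝ} (hr : 0 ≤ r) {D : Set ℝ} (hD : MeasurableSet D) :
    mobiusMeasure r D = ∑' m : ℕ, ENNReal.ofReal (1 / ((m : ℝ) + 1 + r) ^ 2) *
      mobiusMeasure (1 / ((m : ℝ) + 1 + r)) (gaussBranch m ⁻¹' D) := by
  rw [mobiusMeasure_apply r hD, setLIntegral_eq_tsum_gaussBranch]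
  refine tsum_congr fun m => ?_
  rw [mobiusMeasure_apply _ (measurable_gaussBranch m hD), ← lintegral_const_mul']
  · refine setLIntegral_congr_fun measurableSet_Ioo fun s hs => ?_
    by_cases h : gaussBranch m s ∈ D
    · have := hs.1
      simp only [indicator, mem_preimage, h, if_true]
      rw [← ENNReal.ofReal_mul (by positivity), ← ENNReal.ofReal_mul (by positivity), gaussBranch]
      congr 1
      field_simp
      ring
    · simp [indicator, h]
  · exact ENNReal.ofReal_ne_top

lemma mobiusMeasure_Ioc {r b : ℝ} (hr : 0 ≤ r) (hb : 0 ≤ b) (hb1 : b ≤ 1) :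
    mobiusMeasure r (Ioc 0 b) = ENNReal.ofReal (b / (1 + r * b)) := by
  have hcont : ContinuousOn (fun t : ℝ => 1 / (1 + r * t) ^ 2) (Icc 0 b) := by
    refine ContinuousOn.div (by fun_prop) (by fun_prop) fun t ht => ?_
    have := ht.1
    positivity
  rw [mobiusMeasure, withDensity_apply _ measurableSet_Ioc,
    Measure.restrict_congr_set Ioo_ae_eq_Ioc,
    Measure.restrict_restrict measurableSet_Ioc, Ioc_inter_Ioc, max_self, min_eq_left hb1,
    ← ofReal_integral_eq_lintegral_ofReal, ← intervalIntegral.integral_of_le hb]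
  · rw [intervalIntegral.integral_eq_sub_of_hasDerivAt (f := fun t => t / (1 + r * t))]
    · simp
    · intro t ht
      rw [uIcc_of_le hb] at ht
      have := ht.1
      have hne : 1 + r * t ≠ 0 := by positivity
      exact ((hasDerivAt_id' t).fun_div (((hasDerivAt_id' t).const_mul r).const_add 1)
        hne).congr_deriv (by ring)
    · exact hcont.intervalIntegrable_of_Icc hb
  · exact hcont.integrableOn_Icc.mono_set Ioc_subset_Icc_self
  · exact ae_of_all _ fun t => by positivity

/-- Bounded distortion: the `n`-th iterate of the Gauss map is almost independent of the first `n`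
digits. -/
lemma mobiusMeasure_inter_iterate_bounds {b : ℝ} (hb : 0 ≤ b) (hb1 : b ≤ 1) (n : ℕ) :
    ∀ {r : ℝ}, 0 ≤ r → r ≤ 1 → ∀ {D : Set ℝ}, MeasurableSet D → DependsOnDigits n D →
    ENNReal.ofReal b * mobiusMeasure r D ≤ mobiusMeasure r (D ∩ gaussMap^[n] ⁻¹' Ioc 0 b) ∧
    mobiusMeasure r (D ∩ gaussMap^[n] ⁻¹' Ioc 0 b) ≤
      ENNReal.ofReal (2 * b) * mobiusMeasure r D := by
  induction n with
  | zero =>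
    intro r hr hr1 D _ hdep
    rcases (D ∩ Ioo 0 1).eq_empty_or_nonempty with h | ⟨x, hx, hx1⟩
    · have h0 : mobiusMeasure r D = 0 := by
        rw [mobiusMeasure_congr r (D' := ∅), measure_empty]
        exact fun x hx => ⟨fun h' => h.subset ⟨h', hx⟩, False.elim⟩
      simp [h0, measure_mono_null inter_subset_left h0]
    · have hall : ∀ y ∈ Ioo (0 : ℝ) 1, y ∈ D := fun y hy => hdep x hx1 y hy (by simp) hx
      rw [mobiusMeasure_congr r (D := D) (D' := Ioc 0 1)
          fun y hy => ⟨fun _ => ⟨hy.1, hy.2.le⟩, fun _ => hall y hy⟩,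
        mobiusMeasure_congr r (D := D ∩ gaussMap^[0] ⁻¹' Ioc 0 b) (D' := Ioc 0 b)
          fun y hy => ⟨fun h => h.2, fun h => ⟨hall y hy, h⟩⟩,
        mobiusMeasure_Ioc hr hb hb1, mobiusMeasure_Ioc hr zero_le_one le_rfl,
        ← ENNReal.ofReal_mul hb, ← ENNReal.ofReal_mul (by positivity)]
      constructor <;> apply ENNReal.ofReal_le_ofReal
      · rw [mul_one_div]
        gcongr
      · rw [mul_one_div, div_le_div_iff₀ (by positivity) (by positivity)]
        nlinarith [mul_nonneg hb hr, mul_nonneg hb (mul_nonneg hb hr)]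
  | succ n ih =>
    intro r hr hr1 D hD hdep
    have hmeas : MeasurableSet (D ∩ gaussMap^[n + 1] ⁻¹' Ioc 0 b) :=
      hD.inter (measurable_gaussMap.iterate _ measurableSet_Ioc)
    rw [mobiusMeasure_eq_tsum hr hD, mobiusMeasure_eq_tsum hr hmeas, ← ENNReal.tsum_mul_left,
      ← ENNReal.tsum_mul_left]
    have key (m : ℕ) := by
      have hm : (0 : ℝ) ≤ m := m.cast_nonneg
      exact ih (r := 1 / ((m : ℝ) + 1 + r)) (by positivity)
        ((div_le_one (by positivity)).2 (by linarith)) (measurable_gaussBranch m hD)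
        (hdep.preimage m)
    have hset (m : ℕ) := mobiusMeasure_congr (1 / ((m : ℝ) + 1 + r))
      (D := gaussBranch m ⁻¹' (D ∩ gaussMap^[n + 1] ⁻¹' Ioc 0 b))
      (D' := gaussBranch m ⁻¹' D ∩ gaussMap^[n] ⁻¹' Ioc 0 b)
      fun s hs => by simp [gaussMap_gaussBranch hs]
    simp_rw [hset, mul_left_comm (ENNReal.ofReal b), mul_left_comm (ENNReal.ofReal (2 * b))]
    exact ⟨ENNReal.tsum_le_tsum fun m => mul_le_mul_right (key m).1 _,
      ENNReal.tsum_le_tsum fun m => mul_le_mul_right (key m).2 _⟩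

lemma mobiusMeasure_zero : mobiusMeasure 0 = volume.restrict (Ioo 0 1) := by
  simp [mobiusMeasure]

lemma le_gaussDigit_iff {j : ℕ} (hj : j ≠ 0) {u : ℝ} :
    j ≤ gaussDigit u ↔ u ∈ Ioc (0 : ℝ) (1 / j) := by
  have hj' : (0 : ℝ) < j := by positivity
  rw [gaussDigit, Nat.le_floor_iff' hj, mem_Ioc]
  constructor
  · intro h
    have hu : 0 < u := inv_pos.1 (hj'.trans_le h)
    exact ⟨hu, by rw [one_div]; exact (le_inv_comm₀ hj' hu).1 h⟩
  · rintro ⟨hu, h⟩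
    rw [one_div] at h
    exact (le_inv_comm₀ hj' hu).2 h

lemma measure_le_gaussDigit_le (n : ℕ) {j : ℕ} (hj : j ≠ 0) :
    volume.restrict (Ioo (0 : ℝ) 1) {x | j ≤ gaussDigit (gaussMap^[n] x)} ≤
      ENNReal.ofReal (2 / j) := by
  have hj' : (1 : ℝ) ≤ j := by exact_mod_cast Nat.one_le_iff_ne_zero.2 hj
  have h := (mobiusMeasure_inter_iterate_bounds (b := 1 / j) (by positivity)
    ((div_le_one (by positivity)).2 hj') n le_rfl zero_le_one MeasurableSet.univ
    (fun _ _ _ _ _ _ => mem_univ _)).2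
  rw [mobiusMeasure_zero, univ_inter, mul_one_div] at h
  simpa [preimage, le_gaussDigit_iff hj] using h

lemma lintegral_min_gaussDigit_le (n N : ℕ) :
    ∫⁻ x in Ioo (0 : ℝ) 1, ((min (gaussDigit (gaussMap^[n] x)) N : ℕ) : ENNReal) ≤
      ENNReal.ofReal (2 * (1 + log N)) := by
  have hmin (b : ℕ) : ((min b N : ℕ) : ENNReal) =
      ∑ j ∈ Finset.Icc 1 N, if j ≤ b then 1 else 0 := by
    have : (Finset.Icc 1 N).filter (· ≤ b) = Finset.Icc 1 (min b N) := by
      ext j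
      simp only [Finset.mem_filter, Finset.mem_Icc, le_min_iff]
      tauto
    rw [Finset.sum_boole, this, Nat.card_Icc, Nat.add_sub_cancel]
  have hmeas (j : ℕ) : MeasurableSet {x | j ≤ gaussDigit (gaussMap^[n] x)} :=
    measurableSet_le measurable_const
      (measurable_gaussDigit.comp (measurable_gaussMap.iterate n))
  simp_rw [hmin]
  rw [lintegral_finsetSum _ fun j _ => Measurable.ite (hmeas j) measurable_const measurable_const]
  calc _ ≤ ∑ j ∈ Finset.Icc 1 N, ENNReal.ofReal (2 / j) := by
        refine Finset.sum_le_sum fun j hj => ?_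
        have hj0 : j ≠ 0 := by have := (Finset.mem_Icc.1 hj).1; omega
        refine le_trans (le_of_eq ?_) (measure_le_gaussDigit_le n hj0)
        rw [← lintegral_indicator_one (hmeas j)]
        simp [indicator]
    _ = ENNReal.ofReal (∑ j ∈ Finset.Icc 1 N, 2 / (j : ℝ)) :=
        (ENNReal.ofReal_sum_of_nonneg fun j _ => by positivity).symm
    _ ≤ _ := by
        refine ENNReal.ofReal_le_ofReal ?_
        have := harmonic_le_one_add_log N
        rw [harmonic_eq_sum_Icc] at this
        push_cast at this
        simp_rw [div_eq_mul_inv, ← Finset.mul_sum]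
        linarith

/-- The sum of the first `k` regular continued fraction digits in even position. -/
noncomputable def evenDigitSum (k : ℕ) (x : ℝ) : ℕ :=
  birkhoffSum gaussMap^[2] (fun y => gaussDigit (gaussMap y)) k x

lemma evenDigitSum_eq (k : ℕ) (x : ℝ) :
    evenDigitSum k x = ∑ i ∈ Finset.range k, gaussDigit (gaussMap^[2 * i + 1] x) := by
  simp_rw [evenDigitSum, birkhoffSum, ← Function.iterate_mul, ← Function.iterate_succ_apply']

lemma measurable_evenDigitSum (k : ℕ) : Measurable (evenDigitSum k) := by
  rw [funext (evenDigitSum_eq k)]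
  exact Finset.measurable_fun_sum _ fun i _ =>
    measurable_gaussDigit.comp (measurable_gaussMap.iterate _)

lemma measure_lt_evenDigitSum_le {C : ℝ} (hC : 0 < C) {k : ℕ} (hk : k ≠ 0) :
    volume.restrict (Ioo (0 : ℝ) 1) {x | C * k * (1 + 2 * log k) < evenDigitSum k x} ≤
      ENNReal.ofReal (2 / k + 2 / C) := by
  have hk' : (1 : ℝ) ≤ k := by exact_mod_cast Nat.one_le_iff_ne_zero.2 hk
  have hlog : 0 ≤ log k := log_nonneg hk'
  have hsub : {x | C * k * (1 + 2 * log k) < evenDigitSum k x} ⊆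
      (⋃ i ∈ Finset.range k, {x | k ^ 2 ≤ gaussDigit (gaussMap^[2 * i + 1] x)}) ∪
      {x | ENNReal.ofReal (C * k * (1 + 2 * log k)) ≤ ∑ i ∈ Finset.range k,
        ((min (gaussDigit (gaussMap^[2 * i + 1] x)) (k ^ 2) : ℕ) : ENNReal)} := by
    intro x hx
    by_cases h : x ∈ ⋃ i ∈ Finset.range k, {x | k ^ 2 ≤ gaussDigit (gaussMap^[2 * i + 1] x)}
    · exact Or.inl h
    · refine Or.inr ?_
      simp only [mem_iUnion, mem_ofPred_eq, not_exists, not_le] at h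
      rw [mem_ofPred_eq, Finset.sum_congr rfl fun i hi => by rw [min_eq_left (h i hi).le],
        ← Nat.cast_sum, ← evenDigitSum_eq, ← ENNReal.ofReal_natCast]
      exact ENNReal.ofReal_le_ofReal (le_of_lt hx)
  have hmeas (i : ℕ) : Measurable fun x =>
      ((min (gaussDigit (gaussMap^[2 * i + 1] x)) (k ^ 2) : ℕ) : ENNReal) :=
    (measurable_from_top (f := fun m : ℕ => ((min m (k ^ 2) : ℕ) : ENNReal))).comp
      (measurable_gaussDigit.comp (measurable_gaussMap.iterate _))
  refine (measure_mono hsub).trans ((measure_union_le _ _).trans ?_)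
  rw [ENNReal.ofReal_add (by positivity) (by positivity)]
  refine add_le_add ?_ ?_
  · refine (measure_biUnion_finset_le _ _).trans
      ((Finset.sum_le_sum fun i _ => measure_le_gaussDigit_le _ (pow_ne_zero 2 hk)).trans ?_)
    rw [Finset.sum_const, Finset.card_range, nsmul_eq_mul, ← ENNReal.ofReal_natCast,
      ← ENNReal.ofReal_mul (by positivity)]
    refine ENNReal.ofReal_le_ofReal (le_of_eq ?_)
    push_cast
    field_simp
  · refine (meas_ge_le_lintegral_div
      (Finset.measurable_fun_sum _ fun i _ => hmeas i).aemeasurable ?_ ENNReal.ofReal_ne_top).trans ?_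
    · exact (ENNReal.ofReal_pos.2 (by positivity)).ne'
    · refine ENNReal.div_le_of_le_mul ?_
      rw [lintegral_finsetSum _ fun i _ => hmeas i]
      refine (Finset.sum_le_sum fun i _ => lintegral_min_gaussDigit_le _ _).trans ?_
      rw [Finset.sum_const, Finset.card_range, nsmul_eq_mul, ← ENNReal.ofReal_natCast,
        ← ENNReal.ofReal_mul (by positivity), ← ENNReal.ofReal_mul (by positivity)]
      refine ENNReal.ofReal_le_ofReal (le_of_eq ?_)
      push_cast
      rw [log_pow]
      field_simp
      push_cast
      ring

lemma not_summable_one_div_mul_one_add_log {K : ℝ} (hK : 0 < K) :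
    ¬ Summable fun k : ℕ => 1 / (K * k * (1 + 2 * log k) + 2) := by
  have hlog (k : ℕ) : 0 ≤ log (k : ℝ) := log_natCast_nonneg k
  rw [← summable_condensed_iff_of_nonneg (fun k => by have := hlog k; positivity)]
  · intro h
    have h2 : Summable fun k : ℕ => (3 * K + 2)⁻¹ * (1 / ((k + 1 : ℕ) : ℝ)) := by
      refine h.of_nonneg_of_le (fun k => by positivity) fun k => ?_
      push_cast
      rw [log_pow, ← one_div, one_div_mul_one_div, mul_one_div]
      have hl0 : 0 ≤ log 2 := log_nonneg one_le_two
      have hl1 : log 2 ≤ 1 := (log_le_sub_one_of_pos two_pos).trans (by norm_num)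
      have hp : (1 : ℝ) ≤ 2 ^ k := one_le_pow₀ one_le_two
      rw [div_le_div_iff₀ (by positivity) (by positivity)]
      have h3 : (k : ℝ) * log 2 ≤ k := mul_le_of_le_one_right k.cast_nonneg hl1
      have h4 : K * 2 ^ k * (1 + 2 * (k * log 2)) ≤ K * 2 ^ k * (1 + 2 * k) := by gcongr
      nlinarith [mul_nonneg (zero_le_one.trans hp) (k.cast_nonneg (α := ℝ)),
        mul_nonneg (mul_nonneg (zero_le_one.trans hp) (k.cast_nonneg (α := ℝ))) hK.le,
        mul_nonneg (zero_le_one.trans hp) hK.le]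
    rw [summable_mul_left_iff (by positivity),
      summable_nat_add_iff 1 (f := fun k : ℕ => 1 / (k : ℝ))] at h2
    exact Real.not_summable_one_div_natCast h2
  · intro m n hm hmn
    have hm' : (0 : ℝ) < m := by exact_mod_cast hm
    have := hlog m
    gcongr

lemma evenDigitSum_congr {k : ℕ} {x y : ℝ}
    (h : ∀ i < 2 * k, gaussDigit (gaussMap^[i] x) = gaussDigit (gaussMap^[i] y)) :
    evenDigitSum k x = evenDigitSum k y := by
  rw [evenDigitSum_eq, evenDigitSum_eq]
  exact Finset.sum_congr rfl fun i hi => h _ (by have := Finset.mem_range.1 hi; omega)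

/-- The points at which no odd-position digit with block index in `[n, K)` dominates `M` times the
sum of the preceding even-position digits. -/
def noLargeDigit (M n K : ℕ) : Set ℝ :=
  {x | ∀ k, n ≤ k → k < K → gaussDigit (gaussMap^[2 * k] x) < M * evenDigitSum k x + 2}

lemma measurableSet_noLargeDigit (M n K : ℕ) : MeasurableSet (noLargeDigit M n K) := by
  have : noLargeDigit M n K = ⋂ k, ⋂ (_ : n ≤ k), ⋂ (_ : k < K),
      {x | gaussDigit (gaussMap^[2 * k] x) < M * evenDigitSum k x + 2} := by
    ext x
    simp [noLargeDigit]
  rw [this]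
  exact MeasurableSet.iInter fun k => MeasurableSet.iInter fun _ => MeasurableSet.iInter fun _ =>
    measurableSet_lt (measurable_gaussDigit.comp (measurable_gaussMap.iterate _))
      (((measurable_evenDigitSum k).const_mul M).add_const 2)

lemma dependsOnDigits_noLargeDigit (M n K : ℕ) :
    DependsOnDigits (2 * K) (noLargeDigit M n K) := by
  intro x _ y _ h hx k hnk hkK
  rw [← h (2 * k) (by omega), ← evenDigitSum_congr fun i hi => h i (by omega)]
  exact hx k hnk hkK

lemma measureReal_noLargeDigit_succ_le {M n K : ℕ} (hnK : n ≤ K) {F : ℝ} (hF : 0 ≤ F) :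
    1 / (M * F + 2) * ((volume.restrict (Ioo (0 : ℝ) 1)).real (noLargeDigit M n K) -
      (volume.restrict (Ioo (0 : ℝ) 1)).real {x | F < evenDigitSum K x}) ≤
    (volume.restrict (Ioo (0 : ℝ) 1)).real (noLargeDigit M n K) -
      (volume.restrict (Ioo (0 : ℝ) 1)).real (noLargeDigit M n (K + 1)) := by
  set μ := volume.restrict (Ioo (0 : ℝ) 1) with hμ
  set β := 1 / (M * F + 2) with hβ
  have hβ0 : 0 < β := by positivity
  have hβ1 : β ≤ 1 := (div_le_one (by positivity)).2 (by nlinarith [mul_nonneg M.cast_nonneg hF])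
  set B := {x | F < evenDigitSum K x} with hB
  have hBm : MeasurableSet B := measurableSet_lt measurable_const
    (measurable_from_top.comp (measurable_evenDigitSum K))
  set D := noLargeDigit M n K with hD
  have hDm : MeasurableSet D := measurableSet_noLargeDigit M n K
  set A := (D \ B) ∩ gaussMap^[2 * K] ⁻¹' Ioc 0 β with hA
  have hdep : DependsOnDigits (2 * K) (D \ B) := by
    intro x hx y hy h hxD
    refine ⟨dependsOnDigits_noLargeDigit M n K x hx y hy h hxD.1, ?_⟩
    have := hxD.2
    simpa [hB, evenDigitSum_congr h] using this
  have hAge : β * μ.real (D \ B) ≤ μ.real A := by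
    have h := (mobiusMeasure_inter_iterate_bounds hβ0.le hβ1 (2 * K) le_rfl zero_le_one
      (hDm.diff hBm) hdep).1
    rw [mobiusMeasure_zero, ← hμ] at h
    have := ENNReal.toReal_mono (measure_ne_top μ A) h
    rwa [ENNReal.toReal_mul, ENNReal.toReal_ofReal hβ0.le] at this
  have hsub : noLargeDigit M n (K + 1) ⊆ D \ A := by
    intro x hx
    refine ⟨fun k h1 h2 => hx k h1 (by omega), fun hxA => ?_⟩
    have hlt := hx K hnK (by omega)
    have hE : (evenDigitSum K x : ℝ) ≤ F := by simpa [hB] using hxA.1.2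
    have hu := hxA.2
    have : M * evenDigitSum K x + 2 ≤ gaussDigit (gaussMap^[2 * K] x) := by
      rw [le_gaussDigit_iff (by omega)]
      refine ⟨hu.1, hu.2.trans ?_⟩
      rw [hβ]
      push_cast
      gcongr
    omega
  have hAm : MeasurableSet A :=
    (hDm.diff hBm).inter (measurable_gaussMap.iterate _ measurableSet_Ioc)
  have h1 := measureReal_mono (μ := μ) hsub
  rw [measureReal_sdiff (fun x hx => hx.1.1) hAm] at h1
  have h2 : μ.real D ≤ μ.real (D \ B) + μ.real B :=
    (measureReal_mono (fun x hx => by by_cases h : x ∈ B <;> simp [h, hx])).trans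
      (measureReal_union_le (D \ B) B)
  nlinarith

lemma measure_iInter_noLargeDigit {M : ℕ} (hM : M ≠ 0) (n : ℕ) :
    volume.restrict (Ioo (0 : ℝ) 1) (⋂ K, noLargeDigit M n K) = 0 := by
  set μ := volume.restrict (Ioo (0 : ℝ) 1) with hμ
  by_contra hne
  set c := μ.real (⋂ K, noLargeDigit M n K) with hc
  have hc0 : 0 < c := ENNReal.toReal_pos hne (measure_ne_top _ _)
  set C := 8 / c with hC
  have hC0 : 0 < C := by positivity
  obtain ⟨k₀, hk₀⟩ := exists_nat_ge (8 / c)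
  have hM' : (0 : ℝ) < M := by positivity
  set k₁ := max (max k₀ n) 1 with hk₁
  have hstep (K : ℕ) (hK : k₁ ≤ K) : 1 / (M * C * K * (1 + 2 * log K) + 2) * (c / 2) ≤
      μ.real (noLargeDigit M n K) - μ.real (noLargeDigit M n (K + 1)) := by
    have hKn : n ≤ K := by omega
    have hK0 : K ≠ 0 := by omega
    have hK' : (0 : ℝ) < K := by positivity
    have hlog := log_natCast_nonneg K
    have h1 := measureReal_noLargeDigit_succ_le (M := M) hKn
      (F := C * K * (1 + 2 * log K)) (by positivity)
    have h2 := ENNReal.toReal_mono ENNReal.ofReal_ne_top (measure_lt_evenDigitSum_le hC0 hK0)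
    rw [ENNReal.toReal_ofReal (by positivity)] at h2
    have h3 : 2 / (K : ℝ) ≤ c / 4 := by
      have : (k₀ : ℝ) ≤ K := by exact_mod_cast (show k₀ ≤ K by omega)
      have := hk₀.trans this
      rw [div_le_iff₀ hc0] at this
      rw [div_le_div_iff₀ hK' four_pos]
      linarith
    have h4 : 2 / C = c / 4 := by
      rw [hC]
      field_simp
      norm_num
    have h5 : c ≤ μ.real (noLargeDigit M n K) := measureReal_mono (iInter_subset _ K)
    refine le_trans ?_ h1
    rw [show (M : ℝ) * C * K * (1 + 2 * log K) = M * (C * K * (1 + 2 * log K)) by ring]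
    refine mul_le_mul_of_nonneg_left ?_ (by positivity)
    change μ.real _ ≤ _ at h2
    linarith
  refine not_summable_one_div_mul_one_add_log (K := M * C) (by positivity) ?_
  rw [← summable_nat_add_iff k₁, ← summable_mul_right_iff (show c / 2 ≠ 0 by positivity)]
  refine summable_of_sum_range_le (c := 1) (fun i => ?_) fun m => ?_
  · have := log_natCast_nonneg (i + k₁)
    positivity
  · refine (Finset.sum_le_sum fun i _ => hstep (i + k₁) (by omega)).trans ?_
    have := Finset.sum_range_sub' (fun i => μ.real (noLargeDigit M n (i + k₁))) m
    simp only [add_right_comm _ 1] at this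
    rw [this]
    have h1 : μ.real (noLargeDigit M n (0 + k₁)) ≤ μ.real univ := measureReal_mono (subset_univ _)
    have h2 : μ.real univ = 1 := by simp [hμ]
    linarith [measureReal_nonneg (μ := μ) (s := noLargeDigit M n (m + k₁))]

lemma ae_exists_large_gaussDigit : ∀ᵐ x ∂(volume.restrict (Ioo (0 : ℝ) 1)),
    ∀ M : ℕ, M ≠ 0 → ∀ n : ℕ, ∃ k ≥ n,
      M * evenDigitSum k x + 2 ≤ gaussDigit (gaussMap^[2 * k] x) := by
  rw [ae_all_iff]
  intro M
  by_cases hM : M = 0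
  · simp [hM]
  simp only [ne_eq, hM, not_false_eq_true, true_imp_iff]
  rw [ae_all_iff]
  intro n
  filter_upwards [measure_eq_zero_iff_ae_notMem.1 (measure_iInter_noLargeDigit hM n)] with x hx
  by_contra! h
  exact hx (mem_iInter.2 fun K k hk _ => h k hk)

lemma irrational_negT {y : ℝ} (h : Irrational y) : Irrational (negT y) := by
  have : Irrational (-1 / y) := by
    rw [neg_div, one_div]
    exact h.inv.neg
  exact this.sub_intCast _

lemma negT_mem {y : ℝ} (h : Irrational y) : negT y ∈ Ioo (0 : ℝ) 1 := by
  refine ⟨lt_of_le_of_ne (Int.fract_nonneg _) fun h0 => ?_, Int.fract_lt_one _⟩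
  exact irrational_negT h ⟨0, by simpa [negT] using h0⟩

lemma iterate_negT_mem {y : ℝ} (h : Irrational y) (hy : y ∈ Ioo (0 : ℝ) 1) (n : ℕ) :
    Irrational (negT^[n] y) ∧ negT^[n] y ∈ Ioo (0 : ℝ) 1 := by
  induction n with
  | zero => exact ⟨h, hy⟩
  | succ n ih =>
    rw [Function.iterate_succ_apply']
    exact ⟨irrational_negT ih.1, negT_mem ih.1⟩

lemma two_le_toNat_ceil_one_div {y : ℝ} (hy : y ∈ Ioo (0 : ℝ) 1) : 2 ≤ ⌈1 / y⌉.toNat := by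
  have h1 : 1 < 1 / y := (one_lt_div hy.1).2 hy.2
  have : (1 : ℤ) < ⌈1 / y⌉ := Int.lt_ceil.2 (by simpa using h1)
  omega

/-- The sum of the first `n` negative continued fraction digits of `1 - y`. -/
noncomputable def negDigitSum (n : ℕ) (y : ℝ) : ℕ :=
  birkhoffSum negT (fun z => ⌈1 / z⌉.toNat) n y

lemma sum_negDigit_eq (n : ℕ) (x : ℝ) :
    ∑ k ∈ Finset.Icc 1 n, (negDigit x k : ℝ) = negDigitSum n (1 - x) := by
  have hIcc : Finset.Icc 1 n = Finset.Ico (0 + 1) (n + 1) := by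
    ext k
    simp only [Finset.mem_Icc, Finset.mem_Ico]
    omega
  rw [negDigitSum, birkhoffSum, Nat.cast_sum, Finset.range_eq_Ico, hIcc, ← Finset.sum_Ico_add']
  rfl

lemma two_mul_le_negDigitSum {y : ℝ} (h : Irrational y) (hy : y ∈ Ioo (0 : ℝ) 1) (n : ℕ) :
    2 * n ≤ negDigitSum n y := by
  have := Finset.card_nsmul_le_sum (Finset.range n) (fun k => ⌈1 / negT^[k] y⌉.toNat) 2
    fun k _ => two_le_toNat_ceil_one_div (iterate_negT_mem h hy k).2
  simpa [negDigitSum, birkhoffSum, mul_comm] using this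

lemma negDigitSum_add (m n : ℕ) (y : ℝ) :
    negDigitSum (m + n) y = negDigitSum m y + negDigitSum n (negT^[m] y) :=
  birkhoffSum_add _ _ _ _ _

lemma negDigitSum_one (y : ℝ) : negDigitSum 1 y = ⌈1 / y⌉.toNat := birkhoffSum_one _ _ _

lemma gaussDigit_eq_floor {y : ℝ} (hy : y ∈ Ioo (0 : ℝ) 1) : (gaussDigit y : ℝ) = ⌊y⁻¹⌋ :=
  natCast_floor_eq_intCast_floor (inv_nonneg.2 hy.1.le)

/-- A run of digits `2` of the negative continued fraction followed by a larger digit corresponds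
to two consecutive digits of the regular one. -/
lemma negT_block (a : ℕ) : ∀ {y : ℝ}, Irrational y → y ∈ Ioo (0 : ℝ) 1 → gaussDigit y = a + 1 →
    negDigitSum a (1 - y) = 2 * a ∧ negT^[a + 1] (1 - y) = 1 - gaussMap^[2] y ∧
      negDigitSum (a + 1) (1 - y) = 2 * (a + 1) + gaussDigit (gaussMap y) := by
  induction a with
  | zero =>
    intro y hirr hy ha
    have hg := gaussMap_mem hirr
    have hgi := irrational_gaussMap hirr
    have hy0 := hy.1.ne'
    have hdig := gaussDigit_eq_floor hy
    rw [ha] at hdig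
    have hinv : y⁻¹ = 1 + gaussMap y := by
      rw [gaussMap, Int.fract, ← hdig]
      simp
    have hg0 := hg.1
    have hone : 1 / (1 - y) = 1 + (gaussMap y)⁻¹ := by
      have : 1 - y = gaussMap y / (1 + gaussMap y) := by
        rw [eq_div_iff (by positivity), ← hinv, sub_mul, one_mul, mul_inv_cancel₀ hy0, hinv]
        ring
      rw [this]
      field_simp
      ring
    refine ⟨rfl, ?_, ?_⟩
    · have hfr : Int.fract (gaussMap y)⁻¹ ≠ 0 := (gaussMap_mem hgi).1.ne'
      simp only [zero_add, Function.iterate_succ_apply,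
        Function.iterate_zero_apply]
      rw [negT, neg_div, hone, Int.fract_neg (by rwa [Int.fract_one_add]), Int.fract_one_add]
      rfl
    · rw [zero_add, negDigitSum_one, hone, Int.ceil_one_add]
      have h1 := gaussDigit_eq_floor hg
      have h2 : ⌈(gaussMap y)⁻¹⌉ = (gaussDigit (gaussMap y) : ℤ) + 1 := by
        rw [Int.ceil_eq_iff]
        have h3 := Int.floor_le (gaussMap y)⁻¹
        have h4 := Int.lt_floor_add_one (gaussMap y)⁻¹
        push_cast
        rw [h1]
        refine ⟨lt_of_le_of_ne (by linarith) fun h => ?_, h4.le⟩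
        exact hgi.inv.ne_int ⌊(gaussMap y)⁻¹⌋ (by linarith)
      omega
  | succ a ih =>
    intro y hirr hy ha
    have hdig : a + 1 + 1 ≤ gaussDigit y := ha.ge
    rw [le_gaussDigit_iff (by omega)] at hdig
    have hlt : y < 1 / 2 := by
      refine lt_of_le_of_ne (hdig.2.trans ?_) fun h => hirr ⟨1 / 2, by rw [h]; norm_num⟩
      push_cast
      have : (0 : ℝ) ≤ a := a.cast_nonneg
      exact one_div_le_one_div_of_le two_pos (by linarith)
    have hy0 := hy.1
    have h1y : 0 < 1 - y := by linarith
    set z := y / (1 - y) with hz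
    have hzi : z⁻¹ = y⁻¹ - 1 := by
      rw [hz]
      field_simp
    have hzmem : z ∈ Ioo (0 : ℝ) 1 := ⟨by positivity, (div_lt_one h1y).2 (by linarith)⟩
    have hzirr : Irrational z := by
      have : Irrational z⁻¹ := by
        rw [hzi]
        simpa using hirr.inv.sub_intCast 1
      simpa using this.inv
    have hone : 1 / (1 - y) = 1 + z := by
      rw [hz]
      field_simp
      ring
    have hfz : Int.fract z = z := Int.fract_eq_self.2 ⟨hzmem.1.le, hzmem.2⟩
    have hT : negT (1 - y) = 1 - z := by
      rw [negT, neg_div, hone, Int.fract_neg (by rw [Int.fract_one_add, hfz]; exact hzmem.1.ne'),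
        Int.fract_one_add, hfz]
    have hd : ⌈1 / (1 - y)⌉.toNat = 2 := by
      have : ⌈1 / (1 - y)⌉ = 2 := by
        rw [hone, Int.ceil_eq_iff]
        push_cast
        constructor <;> linarith [hzmem.1, hzmem.2]
      rw [this]
      rfl
    have hgz : gaussMap z = gaussMap y := by
      rw [gaussMap, hzi, Int.fract_sub_one, gaussMap]
    have hdz : gaussDigit z = a + 1 := by
      rw [gaussDigit, hzi, Nat.floor_sub_one]
      change gaussDigit y - 1 = _
      omega
    obtain ⟨h1, h2, h3⟩ := ih hzirr hzmem hdz
    have hsum (m : ℕ) : negDigitSum (m + 1) (1 - y) = 2 + negDigitSum m (1 - z) := by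
      rw [add_comm, negDigitSum_add, negDigitSum_one, hd, Function.iterate_one, hT]
    refine ⟨?_, ?_, ?_⟩
    · rw [hsum, h1]
      ring
    · rw [Function.iterate_succ_apply, hT, h2]
      simp [hgz]
    · rw [hsum, h3, hgz]
      ring

lemma iterate_gaussMap_mem {x : ℝ} (h : Irrational x) (hx : x ∈ Ioo (0 : ℝ) 1) (n : ℕ) :
    Irrational (gaussMap^[n] x) ∧ gaussMap^[n] x ∈ Ioo (0 : ℝ) 1 := by
  induction n with
  | zero => exact ⟨h, hx⟩
  | succ n ih =>
    rw [Function.iterate_succ_apply']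
    exact ⟨irrational_gaussMap ih.1, gaussMap_mem ih.1⟩

lemma one_le_gaussDigit {x : ℝ} (hx : x ∈ Ioo (0 : ℝ) 1) : 1 ≤ gaussDigit x :=
  (le_gaussDigit_iff one_ne_zero).2 ⟨hx.1, by simpa using hx.2.le⟩

lemma exists_negDigitSum_eq {x : ℝ} (h : Irrational x) (hx : x ∈ Ioo (0 : ℝ) 1) (k : ℕ) :
    ∃ N ≥ k, negT^[N] (1 - x) = 1 - gaussMap^[2 * k] x ∧
      negDigitSum N (1 - x) = 2 * N + evenDigitSum k x := by
  induction k with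
  | zero => exact ⟨0, le_rfl, rfl, rfl⟩
  | succ k ih =>
    obtain ⟨N, hN, hT, hS⟩ := ih
    obtain ⟨hirr, hmem⟩ := iterate_gaussMap_mem h hx (2 * k)
    have hpos := one_le_gaussDigit hmem
    obtain ⟨-, h2, h3⟩ := negT_block (gaussDigit (gaussMap^[2 * k] x) - 1) hirr hmem (by omega)
    refine ⟨N + (gaussDigit (gaussMap^[2 * k] x) - 1 + 1), by omega, ?_, ?_⟩
    · rw [add_comm N, Function.iterate_add_apply, hT, h2, ← Function.iterate_add_apply]
      congr 2
      omega
    · rw [negDigitSum_add, hT, hS, h3, evenDigitSum_eq, evenDigitSum_eq, Finset.sum_range_succ,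
        Function.iterate_succ_apply']
      ring

/-- For a.e. irrational `x ∈ (0,1)`, the liminf of the arithmetic means of the
negative continued fraction digits is `2`. -/
theorem negDigit_mean_liminf_eq_two :
    ∀ᵐ x ∂(volume.restrict (Set.Ioo (0 : ℝ) 1)), Irrational x →
      Filter.liminf
        (fun n : ℕ => (1 / n : ℝ) * ∑ k ∈ Finset.Icc 1 n, (negDigit x k : ℝ)) atTop = 2 := by
  filter_upwards [ae_exists_large_gaussDigit, ae_restrict_mem measurableSet_Ioo] with x hlarge hx h
  simp_rw [sum_negDigit_eq]
  have h1 : Irrational (1 - x) := by simpa using h.intCast_sub 1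
  have hx1 : 1 - x ∈ Ioo (0 : ℝ) 1 := ⟨by linarith [hx.2], by linarith [hx.1]⟩
  have hlow : ∀ᶠ n : ℕ in atTop, (2 : ℝ) ≤ 1 / n * negDigitSum n (1 - x) := by
    filter_upwards [eventually_gt_atTop 0] with n hn
    have hn' : (0 : ℝ) < n := by exact_mod_cast hn
    rw [one_div_mul_eq_div, le_div_iff₀ hn']
    exact_mod_cast two_mul_le_negDigitSum h1 hx1 n
  have hfreq (M : ℕ) (hM : M ≠ 0) :
      ∃ᶠ n : ℕ in atTop, 1 / (n : ℝ) * negDigitSum n (1 - x) ≤ 2 + 1 / M := by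
    rw [frequently_atTop]
    intro n₀
    obtain ⟨k, hk, hdig⟩ := hlarge M hM n₀
    obtain ⟨N, hN, hT, hS⟩ := exists_negDigitSum_eq h hx k
    obtain ⟨hirr, hmem⟩ := iterate_gaussMap_mem h hx (2 * k)
    set a := gaussDigit (gaussMap^[2 * k] x) - 1 with ha
    have hsum : negDigitSum (N + a) (1 - x) = 2 * (N + a) + evenDigitSum k x := by
      rw [negDigitSum_add, hT, hS, (negT_block a hirr hmem (by omega)).1]
      ring
    refine ⟨N + a, by omega, ?_⟩
    have hM' : (0 : ℝ) < M := by positivity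
    have hpos : (0 : ℝ) < (N + a : ℕ) := by exact_mod_cast (show 0 < N + a by omega)
    have hle : ((M * evenDigitSum k x : ℕ) : ℝ) ≤ (N + a : ℕ) := by
      exact_mod_cast (show M * evenDigitSum k x ≤ N + a by omega)
    rw [one_div_mul_eq_div, div_le_iff₀ hpos, hsum]
    push_cast at hle ⊢
    have : (evenDigitSum k x : ℝ) ≤ 1 / M * (N + a) := by
      rw [one_div_mul_eq_div, le_div_iff₀ hM']
      linarith
    linarith
  refine le_antisymm (le_of_forall_pos_le_add fun ε hε => ?_) ?_
  · obtain ⟨m, hm⟩ := exists_nat_one_div_lt hε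
    have := liminf_le_of_frequently_le (hfreq (m + 1) m.succ_ne_zero)
      (isBoundedUnder_of_eventually_ge hlow)
    push_cast at this
    linarith
  · exact le_liminf_of_le (IsCoboundedUnder.of_frequently_le (hfreq 1 one_ne_zero)) hlow
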